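/- Let G be an algebraic group and F, H closed subgroups with FH closed in G. Then the tangent space at the identity e of the double coset FH equals Lie(F) + Lie(H) as a subspace of Lie(G). -/

import Mathlib

variable (k : Type) [Field k] [CharZero k] [IsAlgClosed k] (m : ℕ)

/-- Evaluation of a polynomial in the matrix entries at a matrix `x`. -/
noncomputable def evalAt (x : Matrix (Fin m) (Fin m) k) :
    MvPolynomial (Fin m × Fin m) k →ₐ[k] k :=
  MvPolynomial.aeval fun p => x p.1 p.2

/-- The vanishing ideal `I(S)` of a set of matrices. -/
def vanishingIdealM (S : Set (Matrix (Fin m) (Fin m) k)) :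
    Set (MvPolynomial (Fin m × Fin m) k) :=
  {p | ∀ x ∈ S, evalAt k m x p = 0}

/-- The directional derivative at `x` in direction `v` of a polynomial `p` in the
matrix entries. -/
noncomputable def dirDeriv (x v : Matrix (Fin m) (Fin m) k)
    (p : MvPolynomial (Fin m × Fin m) k) : k :=
  ∑ q : Fin m × Fin m, v q.1 q.2 * evalAt k m x (MvPolynomial.pderiv q p)

/-- The (Zariski) tangent space of `S` at `x`: directions annihilated by the
differentials of all polynomials vanishing on `S`. -/
def tangentAt (x : Matrix (Fin m) (Fin m) k) (S : Set (Matrix (Fin m) (Fin m) k)) :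
    Set (Matrix (Fin m) (Fin m) k) :=
  {v | ∀ p ∈ vanishingIdealM k m S, dirDeriv k m x v p = 0}

/-- `S` is Zariski closed: it is the zero locus of its vanishing ideal. -/
def IsZarClosed (S : Set (Matrix (Fin m) (Fin m) k)) : Prop :=
  ∀ x, (∀ p ∈ vanishingIdealM k m S, evalAt k m x p = 0) → x ∈ S

/-- `S` is Zariski closed in `T`. -/
def IsZarClosedIn (S T : Set (Matrix (Fin m) (Fin m) k)) : Prop :=
  ∀ x ∈ T, (∀ p ∈ vanishingIdealM k m S, evalAt k m x p = 0) → x ∈ S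

/-- The set of matrices underlying a subgroup of `GL_m`. -/
def matSet (F : Subgroup (Matrix.GeneralLinearGroup (Fin m) k)) :
    Set (Matrix (Fin m) (Fin m) k) :=
  (fun g : Matrix.GeneralLinearGroup (Fin m) k => (g : Matrix (Fin m) (Fin m) k)) '' F

/-- A field extension in characteristic zero is formally smooth. -/
theorem formallySmooth_of_charZero (K L : Type) [Field K] [CharZero K] [Field L] [Algebra K L] :
    Algebra.FormallySmooth K L := by
  obtain ⟨s, hs⟩ := exists_isTranscendenceBasis K L
  have : Algebra.IsAlgebraic (IntermediateField.adjoin K (Set.range ((↑) : s → L))) L :=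
    hs.isAlgebraic_field
  exact .of_algebraicIndependent_of_isSeparable hs.1

/-- In characteristic zero, derivations from a domain into a field containing it extend to
that field. -/
theorem Derivation.exists_extend_of_charZero {K S L : Type} [Field K] [CharZero K] [CommRing S]
    [IsDomain S] [Field L] [Algebra K S] [Algebra K L] [Algebra S L] [IsScalarTower K S L]
    [FaithfulSMul S L] (d : Derivation K S L) :
    ∃ D : Derivation K L L, ∀ s, D (algebraMap S L s) = d s := by
  let := FractionRing.liftAlgebra S L
  have : CharZero (FractionRing S) :=
    charZero_of_injective_algebraMap (algebraMap K (FractionRing S)).injective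
  have := formallySmooth_of_charZero (FractionRing S) L
  have : Algebra.FormallySmooth S (FractionRing S) := .of_isLocalization (nonZeroDivisors S)
  have : Algebra.FormallySmooth S L := .comp S (FractionRing S) L
  have hinj : LinearMap.ker (KaehlerDifferential.mapBaseChange K S L) = ⊥ := by
    rw [LinearMap.ker_eq_bot']
    intro x hx
    obtain ⟨y, rfl⟩ := (Algebra.H1Cotangent.exact_δ_mapBaseChange K S L x).1 hx
    rw [Subsingleton.elim y 0, map_zero]
  obtain ⟨g, hg⟩ := LinearMap.exists_leftInverse_of_injective _ hinj
  let e := (d.liftKaehlerDifferential).liftBaseChange L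
  refine ⟨(e ∘ₗ g).compDer (KaehlerDifferential.D K L), fun s => ?_⟩
  have h := LinearMap.congr_fun hg (1 ⊗ₜ KaehlerDifferential.D K S s)
  simp only [LinearMap.comp_apply, KaehlerDifferential.mapBaseChange_tmul, one_smul,
    KaehlerDifferential.map_D, LinearMap.id_apply] at h
  simp [e, h]

theorem exists_derivation_comp_eq {K R L : Type} [Field K] [CharZero K] [CommRing R]
    [Field L] [Algebra K R] [Algebra K L] (ψ : R →ₐ[K] L) (d : R →ₗ[K] L)
    (hd : ∀ a b, d (a * b) = ψ a * d b + ψ b * d a) (hker : ∀ a, ψ a = 0 → d a = 0) :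
    ∃ D : Derivation K L L, ∀ a, D (ψ a) = d a := by
  have hwd : ∀ a b, ψ a = ψ b → d a = d b := fun a b h => by
    rw [← sub_eq_zero, ← map_sub]
    exact hker _ (by rw [map_sub, h, sub_self])
  have hsurj : ∀ s : ψ.range, ∃ a, ψ a = s := fun s => s.2
  choose σ hσ using hsurj
  let d' : ψ.range →ₗ[K] L :=
    { toFun := fun s => d (σ s)
      map_add' := fun s t => by
        rw [← map_add]
        exact hwd _ _ (by simp [hσ])
      map_smul' := fun c s => by
        rw [RingHom.id_apply, ← map_smul]
        exact hwd _ _ (by simp [hσ]) }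
  have hd' : ∀ a (h : ψ a ∈ ψ.range), d' ⟨ψ a, h⟩ = d a := fun a h => hwd _ _ (hσ _)
  obtain ⟨D, hD⟩ := Derivation.exists_extend_of_charZero (Derivation.mk' d' fun s t => by
    obtain ⟨_, a, rfl⟩ := s
    obtain ⟨_, b, rfl⟩ := t
    refine (hwd _ (a * b) ?_).trans ((hd a b).trans ?_)
    · rw [hσ, map_mul]; rfl
    · rw [← hd' a ⟨a, rfl⟩, ← hd' b ⟨b, rfl⟩]; rfl)
  exact ⟨D, fun a => (hD ⟨ψ a, a, rfl⟩).trans (hd' a _)⟩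

theorem Ideal.exists_mul_pow_mem_of_mem_minimalPrimes {R : Type} [CommRing R] {I q : Ideal R}
    (hq : q ∈ I.minimalPrimes) {x : R} (hx : x ∈ q) : ∃ s ∉ q, ∃ n, s * x ^ n ∈ I := by
  have := hq.1.1
  have h : algebraMap R (Localization.AtPrime q) x ∈
      (I.map (algebraMap R (Localization.AtPrime q))).radical := by
    rw [IsLocalization.AtPrime.radical_map_of_mem_minimalPrimes _ q I hq]
    exact Ideal.mem_map_of_mem _ hx
  obtain ⟨n, hn⟩ := h
  rw [← map_pow, IsLocalization.algebraMap_mem_map_algebraMap_iff q.primeCompl] at hn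
  obtain ⟨s, hs, h⟩ := hn
  exact ⟨s, hs, n, h⟩

/-- The chain rule for a derivation applied to a polynomial expression. -/
theorem Derivation.leibniz_mvPolynomial_aeval {K L σ : Type} [Fintype σ] [CommRing K] [CommRing L]
    [Algebra K L] (D : Derivation K L L) (x : σ → L) (p : MvPolynomial σ K) :
    D (MvPolynomial.aeval x p) =
      ∑ q, MvPolynomial.aeval x (MvPolynomial.pderiv q p) * D (x q) := by
  classical
  induction p using MvPolynomial.induction_on with
  | C c => simp
  | add p r hp hr => simp [hp, hr, add_mul, Finset.sum_add_distrib]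
  | mul_X p i hp =>
    simp only [map_mul, MvPolynomial.aeval_X, Derivation.leibniz, smul_eq_mul, hp,
      MvPolynomial.pderiv_X, map_add, add_mul, Finset.sum_add_distrib, Finset.mul_sum]
    congr 1
    · rw [Finset.sum_eq_single i] <;> simp +contextual [eq_comm]
    · exact Finset.sum_congr rfl fun q _ => by ring

theorem Derivation.map_matrix_mul {K L n : Type} [Fintype n] [CommRing K] [CommRing L]
    [Algebra K L] (D : Derivation K L L) (A B : Matrix n n L) :
    (A * B).map D = A.map D * B + A * B.map D := by
  ext i j
  simp only [Matrix.map_apply, Matrix.mul_apply, Matrix.add_apply, map_sum, Derivation.leibniz,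
    smul_eq_mul, ← Finset.sum_add_distrib]
  exact Finset.sum_congr rfl fun _ _ => by ring

theorem eq_add_of_mul_eq_one {R : Type} [Ring R] {x x' y y' dx dy v : R} (hx : x' * x = 1)
    (hy : y * y' = 1) (h : dx * y + x * dy = x * v * y) : v = x' * dx + dy * y' := by
  calc v = (x' * x) * v * (y * y') := by rw [hx, hy, one_mul, mul_one]
    _ = x' * (x * v * y) * y' := by simp only [mul_assoc]
    _ = x' * dx * (y * y') + (x' * x) * dy * y' := by
      rw [← h]; simp only [mul_add, add_mul, mul_assoc]
    _ = _ := by rw [hx, hy, one_mul, mul_one]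

section MatrixPolynomials

variable {k : Type} [Field k] {m : ℕ}

theorem dirDeriv_C (x v : Matrix (Fin m) (Fin m) k) (c : k) :
    dirDeriv k m x v (MvPolynomial.C c) = 0 := by
  simp [dirDeriv]

theorem dirDeriv_X (x v : Matrix (Fin m) (Fin m) k) (q : Fin m × Fin m) :
    dirDeriv k m x v (MvPolynomial.X q) = v q.1 q.2 := by
  rw [dirDeriv, Finset.sum_eq_single q] <;>
    simp +contextual [MvPolynomial.pderiv_X, eq_comm]

theorem dirDeriv_add (x v : Matrix (Fin m) (Fin m) k) (p r : MvPolynomial (Fin m × Fin m) k) :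
    dirDeriv k m x v (p + r) = dirDeriv k m x v p + dirDeriv k m x v r := by
  simp [dirDeriv, mul_add, Finset.sum_add_distrib]

theorem dirDeriv_mul (x v : Matrix (Fin m) (Fin m) k) (p r : MvPolynomial (Fin m × Fin m) k) :
    dirDeriv k m x v (p * r) =
      evalAt k m x p * dirDeriv k m x v r + evalAt k m x r * dirDeriv k m x v p := by
  simp only [dirDeriv, Derivation.leibniz, smul_eq_mul, map_add, map_mul, Finset.mul_sum,
    ← Finset.sum_add_distrib]
  exact Finset.sum_congr rfl fun q _ => by ring

theorem dirDeriv_smul (x v : Matrix (Fin m) (Fin m) k) (c : k)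
    (p : MvPolynomial (Fin m × Fin m) k) :
    dirDeriv k m x v (c • p) = c * dirDeriv k m x v p := by
  rw [MvPolynomial.smul_eq_C_mul, dirDeriv_mul, dirDeriv_C]
  simp [evalAt]

/-- The directional derivative as a linear map in the polynomial. -/
noncomputable def dirDerivₗ (x v : Matrix (Fin m) (Fin m) k) :
    MvPolynomial (Fin m × Fin m) k →ₗ[k] k where
  toFun := dirDeriv k m x v
  map_add' := dirDeriv_add x v
  map_smul' := dirDeriv_smul x v

theorem dirDeriv_add_left (x v w : Matrix (Fin m) (Fin m) k)
    (p : MvPolynomial (Fin m × Fin m) k) :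
    dirDeriv k m x (v + w) p = dirDeriv k m x v p + dirDeriv k m x w p := by
  simp [dirDeriv, add_mul, Finset.sum_add_distrib]

theorem add_mem_tangentAt {x v w : Matrix (Fin m) (Fin m) k}
    {S : Set (Matrix (Fin m) (Fin m) k)} (hv : v ∈ tangentAt k m x S)
    (hw : w ∈ tangentAt k m x S) : v + w ∈ tangentAt k m x S := fun p hp => by
  rw [dirDeriv_add_left, hv p hp, hw p hp, add_zero]

theorem tangentAt_mono (x : Matrix (Fin m) (Fin m) k) {S T : Set (Matrix (Fin m) (Fin m) k)}
    (h : S ⊆ T) : tangentAt k m x S ⊆ tangentAt k m x T :=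
  fun _ hv p hp => hv p fun y hy => hp y (h hy)

/-- The vanishing ideal of a set of matrices, as an ideal. -/
noncomputable def matVanishingIdeal (S : Set (Matrix (Fin m) (Fin m) k)) :
    Ideal (MvPolynomial (Fin m × Fin m) k) where
  carrier := vanishingIdealM k m S
  add_mem' hp hr x hx := by rw [map_add, hp x hx, hr x hx, add_zero]
  zero_mem' x _ := map_zero _
  smul_mem' c p hp x hx := by rw [smul_eq_mul, map_mul, hp x hx, mul_zero]

/-- The substitution `X ↦ α X β` in polynomials in the matrix entries. -/
noncomputable def mulLeftRight (α β : Matrix (Fin m) (Fin m) k) :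
    MvPolynomial (Fin m × Fin m) k →ₐ[k] MvPolynomial (Fin m × Fin m) k :=
  MvPolynomial.aeval fun q =>
    ∑ b, β b q.2 • ∑ a, α q.1 a • MvPolynomial.X (a, b)

theorem evalAt_mulLeftRight (α β x : Matrix (Fin m) (Fin m) k)
    (p : MvPolynomial (Fin m × Fin m) k) :
    evalAt k m x (mulLeftRight α β p) = evalAt k m (α * x * β) p := by
  rw [← AlgHom.comp_apply]
  congr 1
  ext q
  simp [evalAt, mulLeftRight, Matrix.mul_apply, mul_comm]

theorem dirDeriv_mulLeftRight (α β x v : Matrix (Fin m) (Fin m) k)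
    (p : MvPolynomial (Fin m × Fin m) k) :
    dirDeriv k m x v (mulLeftRight α β p) = dirDeriv k m (α * x * β) (α * v * β) p := by
  induction p using MvPolynomial.induction_on with
  | C c =>
    rw [← MvPolynomial.algebraMap_eq, AlgHom.commutes, MvPolynomial.algebraMap_eq,
      dirDeriv_C, dirDeriv_C]
  | add p r hp hr => rw [map_add, dirDeriv_add, dirDeriv_add, hp, hr]
  | mul_X p q hp =>
    rw [map_mul, dirDeriv_mul, dirDeriv_mul, hp, evalAt_mulLeftRight, evalAt_mulLeftRight]
    congr 2
    rw [dirDeriv_X, mulLeftRight, MvPolynomial.aeval_X]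
    change dirDerivₗ x v _ = _
    have hX (q : Fin m × Fin m) : dirDerivₗ x v (MvPolynomial.X q) = v q.1 q.2 := dirDeriv_X x v q
    simp [hX, Matrix.mul_apply, mul_comm]

theorem mulLeftRight_mem {α β : Matrix (Fin m) (Fin m) k} {S T : Set (Matrix (Fin m) (Fin m) k)}
    (h : ∀ s ∈ S, α * s * β ∈ T) {p : MvPolynomial (Fin m × Fin m) k}
    (hp : p ∈ vanishingIdealM k m T) : mulLeftRight α β p ∈ vanishingIdealM k m S := fun s hs => by
  rw [evalAt_mulLeftRight]
  exact hp _ (h s hs)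

/-- The matrix obtained from a family of matrices by applying an algebra homomorphism to its
entry functions. -/
def familyMatrix {ι L : Type} [CommRing L] [Algebra k L] (Φ : (ι → k) →ₐ[k] L)
    (α : ι → Matrix (Fin m) (Fin m) k) : Matrix (Fin m) (Fin m) L :=
  Matrix.of fun a b => Φ fun i => α i a b

section Family

variable {ι L : Type} [CommRing L] [Algebra k L] (Φ : (ι → k) →ₐ[k] L)

theorem familyMatrix_mul (α β : ι → Matrix (Fin m) (Fin m) k) :
    familyMatrix Φ (fun i => α i * β i) = familyMatrix Φ α * familyMatrix Φ β := by
  ext a b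
  simp only [familyMatrix, Matrix.of_apply, Matrix.mul_apply, ← map_mul, ← map_sum]
  congr 1
  ext i
  simp

theorem familyMatrix_const (v : Matrix (Fin m) (Fin m) k) :
    familyMatrix Φ (fun _ => v) = v.map (algebraMap k L) := by
  ext a b
  exact Φ.commutes (v a b)

theorem aeval_familyMatrix (γ : ι → Matrix (Fin m) (Fin m) k)
    (p : MvPolynomial (Fin m × Fin m) k) :
    MvPolynomial.aeval (fun q : Fin m × Fin m => familyMatrix Φ γ q.1 q.2) p =
      Φ fun i => evalAt k m (γ i) p := by
  have h : MvPolynomial.aeval (fun q : Fin m × Fin m => familyMatrix Φ γ q.1 q.2) =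
      Φ.comp (AlgHom.pi fun i => evalAt k m (γ i)) := by
    ext q
    simp only [MvPolynomial.aeval_X, AlgHom.comp_apply, familyMatrix, Matrix.of_apply]
    congr 1
    ext i
    simp [evalAt]
  rw [h]
  rfl

/-- The logarithmic derivative of a family of points of `S`, transported to the identity by
multiplications preserving `S`, is tangent to `S` at the identity. -/
theorem sum_familyMatrix_mul_pderiv_eq_zero (D : Derivation k L L)
    {S : Set (Matrix (Fin m) (Fin m) k)} {α β γ : ι → Matrix (Fin m) (Fin m) k}
    (hS : ∀ i, ∀ s ∈ S, α i * s * β i ∈ S) (hγ : ∀ i, γ i ∈ S) (h1 : ∀ i, α i * γ i * β i = 1)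
    {p : MvPolynomial (Fin m × Fin m) k} (hp : p ∈ vanishingIdealM k m S) :
    ∑ q : Fin m × Fin m, (familyMatrix Φ α * (familyMatrix Φ γ).map D * familyMatrix Φ β) q.1 q.2 *
      algebraMap k L (evalAt k m 1 (MvPolynomial.pderiv q p)) = 0 := by
  obtain ⟨n, P, hP⟩ := Submodule.fg_iff_exists_fin_generating_family.1
    (IsNoetherian.noetherian (matVanishingIdeal S))
  have hPmem : ∀ j, P j ∈ vanishingIdealM k m S := fun j => by
    change P j ∈ matVanishingIdeal S
    rw [← hP]
    exact Submodule.subset_span ⟨j, rfl⟩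
  have hg : ∀ i, ∃ g : Fin n → MvPolynomial (Fin m × Fin m) k,
      ∑ j, g j • P j = mulLeftRight (α i) (β i) p := fun i => by
    rw [← Submodule.mem_span_range_iff_exists_fun, hP]
    exact mulLeftRight_mem (hS i) hp
  choose g hg using hg
  have key : ∀ i w, dirDeriv k m 1 (α i * w * β i) p =
      ∑ j, evalAt k m (γ i) (g i j) * dirDeriv k m (γ i) w (P j) := fun i w => by
    rw [← h1 i, ← dirDeriv_mulLeftRight, ← hg i]
    change dirDerivₗ (γ i) w _ = _
    rw [map_sum]
    refine Finset.sum_congr rfl fun j _ => ?_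
    change dirDeriv k m (γ i) w (g i j * P j) = _
    rw [dirDeriv_mul, hPmem j _ (hγ i), zero_mul, add_zero]
  have key' : ∀ a b : Fin m,
      ∑ q : Fin m × Fin m, familyMatrix Φ α q.1 a * familyMatrix Φ β b q.2 *
        algebraMap k L (evalAt k m 1 (MvPolynomial.pderiv q p)) =
      ∑ j, Φ (fun i => evalAt k m (γ i) (g i j)) *
        MvPolynomial.aeval (fun q : Fin m × Fin m => familyMatrix Φ γ q.1 q.2)
          (MvPolynomial.pderiv (a, b) (P j)) := fun a b => by
    simp only [aeval_familyMatrix]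
    simp only [familyMatrix, Matrix.of_apply, ← Φ.commutes, ← map_mul,
      ← map_sum]
    congr 1
    ext i
    have h := key i (Matrix.single a b 1)
    have h2 (w : Fin m × Fin m) :
        (Matrix.single a b (1 : k)) w.1 w.2 = if (a, b) = w then 1 else 0 := by
      simp [Matrix.single_apply, Prod.ext_iff]
    have h3 (q : Fin m × Fin m) :
        (α i * Matrix.single a b (1 : k) * β i) q.1 q.2 = α i q.1 a * β i b q.2 := by
      simp [Matrix.mul_apply, Matrix.single_apply, ite_and]
    simp only [dirDeriv, h2, h3, ite_mul, one_mul, zero_mul, Finset.sum_ite_eq,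
      Finset.mem_univ, if_true] at h
    simpa using h
  calc _ = ∑ c : Fin m × Fin m, (∑ q : Fin m × Fin m, familyMatrix Φ α q.1 c.1 *
        familyMatrix Φ β c.2 q.2 * algebraMap k L (evalAt k m 1 (MvPolynomial.pderiv q p))) *
          D (familyMatrix Φ γ c.1 c.2) := by
        simp only [Finset.sum_mul]
        rw [Finset.sum_comm]
        refine Finset.sum_congr rfl fun q _ => ?_
        rw [Fintype.sum_prod_type, Finset.sum_comm]
        simp only [Matrix.mul_apply, Finset.sum_mul, Matrix.map_apply]
        exact Finset.sum_congr rfl fun b _ => Finset.sum_congr rfl fun a _ => by ring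
    _ = ∑ j, Φ (fun i => evalAt k m (γ i) (g i j)) *
        D (MvPolynomial.aeval (fun q : Fin m × Fin m => familyMatrix Φ γ q.1 q.2) (P j)) := by
        simp only [key', Derivation.leibniz_mvPolynomial_aeval, Finset.mul_sum, Finset.sum_mul]
        rw [Finset.sum_comm]
        exact Finset.sum_congr rfl fun q _ => Finset.sum_congr rfl fun a _ => by ring
    _ = 0 := by
        refine Finset.sum_eq_zero fun j _ => ?_
        rw [aeval_familyMatrix, show (fun i => evalAt k m (γ i) (P j)) = 0 from
          funext fun i => hPmem j _ (hγ i), map_zero, map_zero, mul_zero]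

end Family

end MatrixPolynomials

/-- let `G` be an algebraic group (a closed subgroup of some `GL_m`) and
`F, H ⊆ G` closed subgroups such that the double coset `FH` is closed in `G`. Then the
tangent space of `FH` at the identity equals `Lie(F) + Lie(H)` inside `Lie(G)` (tangent
spaces at the identity matrix). -/
theorem stmt4 (G F H : Subgroup (Matrix.GeneralLinearGroup (Fin m) k))
    (hFG : F ≤ G) (hHG : H ≤ G)
    (FHset : Set (Matrix (Fin m) (Fin m) k))
    (hFHset : FHset = (fun g : Matrix.GeneralLinearGroup (Fin m) k =>
      (g : Matrix (Fin m) (Fin m) k)) '' {x | ∃ f ∈ F, ∃ h ∈ H, x = f * h})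
    (hG : IsZarClosed k m (matSet k m G))
    (hF : IsZarClosedIn k m (matSet k m F) (matSet k m G))
    (hH : IsZarClosedIn k m (matSet k m H) (matSet k m G))
    (hFH : IsZarClosedIn k m FHset (matSet k m G)) :
    tangentAt k m 1 FHset =
      {w | ∃ a ∈ tangentAt k m 1 (matSet k m F),
        ∃ b ∈ tangentAt k m 1 (matSet k m H), w = a + b} := by
  apply Set.Subset.antisymm
  · intro v hv
    let ι := F × H
    let ξ : ι → Matrix (Fin m) (Fin m) k := fun i => ((i.1 : Matrix.GeneralLinearGroup (Fin m) k) :)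
    let ξ' : ι → Matrix (Fin m) (Fin m) k :=
      fun i => (((i.1 : Matrix.GeneralLinearGroup (Fin m) k)⁻¹ : Matrix.GeneralLinearGroup (Fin m) k) :)
    let η : ι → Matrix (Fin m) (Fin m) k := fun i => ((i.2 : Matrix.GeneralLinearGroup (Fin m) k) :)
    let η' : ι → Matrix (Fin m) (Fin m) k :=
      fun i => (((i.2 : Matrix.GeneralLinearGroup (Fin m) k)⁻¹ : Matrix.GeneralLinearGroup (Fin m) k) :)
    have hξ (i) : ξ' i * ξ i = 1 := Units.inv_mul _
    have hη (i) : η i * η' i = 1 := Units.mul_inv _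
    have hmem (i) : ξ i * η i ∈ FHset := by
      rw [hFHset]
      exact ⟨i.1 * i.2, ⟨i.1, i.1.2, i.2, i.2.2, rfl⟩, rfl⟩
    have hstable (i : ι) : ∀ s ∈ FHset, ξ i * s * η i ∈ FHset := by
      rw [hFHset]
      rintro _ ⟨_, ⟨f, hf, h, hh, rfl⟩, rfl⟩
      exact ⟨i.1 * (f * h) * i.2, ⟨i.1 * f, mul_mem i.1.2 hf, h * i.2, mul_mem hh i.2.2,
        by simp only [mul_assoc]⟩, by simp [ξ, η]⟩
    let φ : MvPolynomial (Fin m × Fin m) k →ₐ[k] (ι → k) :=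
      AlgHom.pi fun i => evalAt k m (ξ i * η i)
    let δ : MvPolynomial (Fin m × Fin m) k →ₗ[k] (ι → k) :=
      LinearMap.pi fun i => dirDerivₗ (ξ i * η i) (ξ i * v * η i)
    have hδ (p r) : δ (p * r) = φ p * δ r + φ r * δ p := by
      ext i
      exact dirDeriv_mul _ _ p r
    have hδφ (p) (hp : φ p = 0) : δ p = 0 := by
      ext i
      change dirDeriv k m (ξ i * η i) (ξ i * v * η i) p = 0
      have hp' : p ∈ vanishingIdealM k m FHset := by
        rw [hFHset]
        rintro _ ⟨_, ⟨f, hf, h, hh, rfl⟩, rfl⟩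
        exact congrFun hp (⟨f, hf⟩, ⟨h, hh⟩)
      have h := hv _ (mulLeftRight_mem (hstable i) hp')
      rwa [dirDeriv_mulLeftRight, mul_one] at h
    have hker_ne : Ideal.comap φ.toRingHom ⊥ ≠ ⊤ := by
      rw [Ideal.ne_top_iff_one, Ideal.mem_comap, map_one]
      exact fun h => one_ne_zero (h : (1 : ι → k) = 0)
    obtain ⟨q, hq⟩ := Ideal.nonempty_minimalPrimes hker_ne
    obtain ⟨P, hPprime, -, hPq⟩ := Ideal.exists_comap_eq_of_mem_minimalPrimes φ.toRingHom q hq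
    let L := P.ResidueField
    let Φ : (ι → k) →ₐ[k] L := IsScalarTower.toAlgHom k (ι → k) L
    have hΦ (b) : Φ b = 0 ↔ b ∈ P := Ideal.algebraMap_residueField_eq_zero
    have hΦφ (p) : Φ (φ p) = 0 ↔ p ∈ q := by rw [hΦ, ← hPq]; rfl
    obtain ⟨D, hD⟩ := exists_derivation_comp_eq (Φ.comp φ) (Φ.toLinearMap ∘ₗ δ)
      (fun p r => by simp [hδ]) (fun p hp => by
        obtain ⟨s, hs, n, hn⟩ := Ideal.exists_mul_pow_mem_of_mem_minimalPrimes hq ((hΦφ p).1 hp)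
        have hsp : φ (s * p) = 0 := by
          have h : φ s * φ p ^ n = 0 := by rw [← map_pow, ← map_mul]; exact hn
          refine (pow_eq_zero_iff (Nat.succ_ne_zero n)).1 ?_
          rw [map_mul, Nat.succ_eq_add_one]
          linear_combination φ s ^ n * φ p * h
        have h := congrArg Φ ((hδ s p).symm.trans (hδφ _ hsp))
        rw [map_add, map_mul, map_mul, show Φ (φ p) = 0 from hp, zero_mul, add_zero, map_zero] at h
        exact (mul_eq_zero.1 h).resolve_left fun h => hs ((hΦφ s).1 h))
    obtain ⟨π, hπ⟩ := LinearMap.exists_leftInverse_of_injective (Algebra.linearMap k L)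
      (LinearMap.ker_eq_bot.2 (algebraMap k L).injective)
    have hπ1 (c : k) : π (algebraMap k L c) = c := LinearMap.congr_fun hπ c
    have hproj (S : Set (Matrix (Fin m) (Fin m) k)) (a : Matrix (Fin m) (Fin m) L)
        (ha : ∀ p ∈ vanishingIdealM k m S, ∑ q : Fin m × Fin m, a q.1 q.2 *
          algebraMap k L (evalAt k m 1 (MvPolynomial.pderiv q p)) = 0) :
        a.map π ∈ tangentAt k m 1 S := fun p hp => by
      have h := congrArg π (ha p hp)
      simp only [mul_comm _ (algebraMap k L _), ← Algebra.smul_def, map_sum, map_smul,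
        map_zero] at h
      simpa [dirDeriv, mul_comm] using h
    refine ⟨_, hproj _ _ fun p hp => sum_familyMatrix_mul_pderiv_eq_zero Φ D
        (α := ξ') (β := fun _ => 1) (γ := ξ) ?_ ?_ ?_ hp,
      _, hproj _ _ fun p hp => sum_familyMatrix_mul_pderiv_eq_zero Φ D
        (α := fun _ => 1) (β := η') (γ := η) ?_ ?_ ?_ hp, ?_⟩
    · rintro i _ ⟨f, hf, rfl⟩
      exact ⟨i.1⁻¹ * f, mul_mem (inv_mem i.1.2) hf, by simp [ξ']⟩
    · exact fun i => ⟨i.1, i.1.2, rfl⟩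
    · exact fun i => by rw [mul_one, hξ]
    · rintro i _ ⟨h, hh, rfl⟩
      exact ⟨h * (i.2 : Matrix.GeneralLinearGroup (Fin m) k)⁻¹, mul_mem hh (inv_mem i.2.2),
        by simp [η']⟩
    · exact fun i => ⟨i.2, i.2.2, rfl⟩
    · exact fun i => by rw [one_mul, hη]
    have hξL : familyMatrix Φ ξ' * familyMatrix Φ ξ = 1 := by
      rw [← familyMatrix_mul, funext hξ, familyMatrix_const]; simp
    have hηL : familyMatrix Φ η * familyMatrix Φ η' = 1 := by
      rw [← familyMatrix_mul, funext hη, familyMatrix_const]; simp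
    have hDmul : (familyMatrix Φ ξ).map D * familyMatrix Φ η +
        familyMatrix Φ ξ * (familyMatrix Φ η).map D =
        familyMatrix Φ ξ * v.map (algebraMap k L) * familyMatrix Φ η := by
      rw [← familyMatrix_const, ← familyMatrix_mul, ← familyMatrix_mul]
      ext a b
      have h := hD (MvPolynomial.X (a, b))
      have h1 : Φ (φ (MvPolynomial.X (a, b))) = (familyMatrix Φ ξ * familyMatrix Φ η) a b := by
        rw [← familyMatrix_mul, familyMatrix, Matrix.of_apply]
        congr 1
        funext i
        simp [φ, evalAt]
      have h2 : Φ (δ (MvPolynomial.X (a, b))) =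
          familyMatrix Φ (fun i => ξ i * v * η i) a b := by
        rw [familyMatrix, Matrix.of_apply]
        congr 1
        funext i
        exact dirDeriv_X _ _ _
      rw [← Derivation.map_matrix_mul]
      exact (congrArg D h1).symm.trans (h.trans h2)
    have hone : familyMatrix Φ (fun _ : ι => (1 : Matrix (Fin m) (Fin m) k)) = 1 := by
      rw [familyMatrix_const]; simp
    have hsum : v.map (algebraMap k L) =
        familyMatrix Φ ξ' * (familyMatrix Φ ξ).map D * familyMatrix Φ (fun _ : ι => 1) +
        familyMatrix Φ (fun _ : ι => 1) * (familyMatrix Φ η).map D * familyMatrix Φ η' := by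
      rw [hone, mul_one, one_mul]
      exact eq_add_of_mul_eq_one hξL hηL hDmul
    ext a b
    have h := congrArg π (congrFun (congrFun hsum a) b)
    rw [Matrix.map_apply, hπ1, Matrix.add_apply, map_add] at h
    exact h
  · rintro _ ⟨a, ha, b, hb, rfl⟩
    refine add_mem_tangentAt (tangentAt_mono 1 ?_ ha) (tangentAt_mono 1 ?_ hb)
    · rintro _ ⟨f, hf, rfl⟩
      rw [hFHset]
      exact ⟨f, ⟨f, hf, 1, one_mem H, (mul_one f).symm⟩, rfl⟩
    · rintro _ ⟨h, hh, rfl⟩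
      rw [hFHset]
      exact ⟨h, ⟨1, one_mem F, h, hh, (one_mul h).symm⟩, rfl⟩
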